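/- arXiv:2112.06329 — 5 statements merged into one kernel-verified Lean document; each statement's English description precedes it below -/
import Mathlib

section
/- Let d ≥ 3 be an integer, 0 < α < 2, and κ < 0. Then there exists β ∈ (−d, 0) such that 2^{α−2} · β · Γ((d+β)/2) · Γ((α−β)/2) / ( Γ((d+β−α+2)/2) · Γ((2−β)/2) ) = κ. -/
open Real

theorem contAt_Gamma_aux {s : ℝ} (hs : 0 < s) : ContinuousAt Real.Gamma s := by
  refine (Real.differentiableAt_Gamma fun m => ?_).continuousAt
  have : (0 : ℝ) ≤ m := Nat.cast_nonneg m
  intro h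
  linarith

theorem contOn_Gamma_aux {f : ℝ → ℝ} {S : Set ℝ} (hf : Continuous f) (h : ∀ x ∈ S, 0 < f x) :
    ContinuousOn (fun x => Real.Gamma (f x)) S := fun x hx =>
  (ContinuousAt.comp (f := f) (contAt_Gamma_aux (h x hx)) hf.continuousAt).continuousWithinAt

/-- For `d ≥ 3`, `0 < α < 2` and `κ < 0` there exists `β ∈ (−d, 0)` with
`2^{α−2} β Γ((d+β)/2) Γ((α−β)/2) / ( Γ((d+β−α+2)/2) Γ((2−β)/2) ) = κ`. -/
theorem exists_beta_of_kappa_neg (d : ℕ) (hd : 3 ≤ d) (α κ : ℝ) (hα0 : 0 < α) (hα2 : α < 2)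
    (hκ : κ < 0) :
    ∃ β ∈ Set.Ioo (-(d : ℝ)) 0,
      2 ^ (α - 2) * β * Real.Gamma (((d : ℝ) + β) / 2) * Real.Gamma ((α - β) / 2) /
          (Real.Gamma (((d : ℝ) + β - α + 2) / 2) * Real.Gamma ((2 - β) / 2)) = κ := by
  have hd' : (3 : ℝ) ≤ d := by exact_mod_cast hd
  have h2 : (0 : ℝ) < 2 ^ (α - 2) := Real.rpow_pos_of_pos two_pos _
  -- multiply out the denominators and the pole at `β = -d`
  let G : ℝ → ℝ := fun β =>
    2 ^ (α - 2) * β * Real.Gamma (((d : ℝ) + β) / 2 + 1) * Real.Gamma ((α - β) / 2) -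
      κ * (((d : ℝ) + β) / 2) *
        (Real.Gamma (((d : ℝ) + β - α + 2) / 2) * Real.Gamma ((2 - β) / 2))
  have hc : ContinuousOn G (Set.Icc (-(d : ℝ)) 0) := by
    have c1 : ContinuousOn (fun β : ℝ => Real.Gamma (((d : ℝ) + β) / 2 + 1))
        (Set.Icc (-(d : ℝ)) 0) :=
      contOn_Gamma_aux (by fun_prop) (fun x hx => by linarith [hx.1])
    have c2 : ContinuousOn (fun β : ℝ => Real.Gamma ((α - β) / 2)) (Set.Icc (-(d : ℝ)) 0) :=
      contOn_Gamma_aux (by fun_prop) (fun x hx => by linarith [hx.2])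
    have c3 : ContinuousOn (fun β : ℝ => Real.Gamma (((d : ℝ) + β - α + 2) / 2))
        (Set.Icc (-(d : ℝ)) 0) :=
      contOn_Gamma_aux (by fun_prop) (fun x hx => by linarith [hx.1])
    have c4 : ContinuousOn (fun β : ℝ => Real.Gamma ((2 - β) / 2)) (Set.Icc (-(d : ℝ)) 0) :=
      contOn_Gamma_aux (by fun_prop) (fun x hx => by linarith [hx.2])
    exact (((by fun_prop : ContinuousOn (fun β : ℝ => 2 ^ (α - 2) * β) _).mul c1).mul c2).sub
      ((by fun_prop : ContinuousOn (fun β : ℝ => κ * (((d : ℝ) + β) / 2)) _).mul (c3.mul c4))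
  have hl : G (-(d : ℝ)) < 0 := by
    have g : 0 < Real.Gamma ((α - -(d : ℝ)) / 2) := Real.Gamma_pos_of_pos (by linarith)
    have e : G (-(d : ℝ)) = -(2 ^ (α - 2) * d * Real.Gamma ((α - -(d : ℝ)) / 2)) := by
      simp [G]
    rw [e]
    have : (0 : ℝ) < d := by linarith
    have := mul_pos (mul_pos h2 this) g
    linarith
  have hr : 0 < G 0 := by
    have g3 : 0 < Real.Gamma (((d : ℝ) + 0 - α + 2) / 2) := Real.Gamma_pos_of_pos (by linarith)
    have g4 : 0 < Real.Gamma ((2 - 0 : ℝ) / 2) := Real.Gamma_pos_of_pos (by norm_num)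
    have e : G 0 = (-κ) * (((d : ℝ) + 0) / 2) *
        (Real.Gamma (((d : ℝ) + 0 - α + 2) / 2) * Real.Gamma ((2 - 0) / 2)) := by
      simp only [G]; ring
    rw [e]
    exact mul_pos (mul_pos (by linarith) (by linarith)) (mul_pos g3 g4)
  obtain ⟨β, hβ, h0⟩ := intermediate_value_Ioo (by linarith : -(d : ℝ) ≤ 0) hc ⟨hl, hr⟩
  refine ⟨β, hβ, ?_⟩
  obtain ⟨hβ1, hβ2⟩ := hβ
  have p : 0 < ((d : ℝ) + β) / 2 := by linarith
  have g3 : 0 < Real.Gamma (((d : ℝ) + β - α + 2) / 2) := Real.Gamma_pos_of_pos (by linarith)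
  have g4 : 0 < Real.Gamma ((2 - β) / 2) := Real.Gamma_pos_of_pos (by linarith)
  rw [div_eq_iff (mul_pos g3 g4).ne']
  simp only [G] at h0
  rw [Real.Gamma_add_one p.ne'] at h0
  apply mul_left_cancel₀ p.ne'
  linear_combination h0
end

section
/- Let d ≥ 3 be an integer, 0 < α ≤ 1, κ > 0, and ε > 0. Define b_ε : ℝ^d → ℝ^d by b_ε(x) := κ (|x|^2 + ε)^{−α/2} x. Then b_ε is differentiable everywhere, and for all x, w ∈ ℝ^d, writing |x|_ε := √(|x|^2 + ε) and Db_ε(x) for the derivative (Jacobian) of b_ε at x: κ(1−α) |x|_ε^{−α} |w|^2 ≤ ⟨ Db_ε(x) w , w ⟩ ≤ κ |x|_ε^{−α} |w|^2; in particular the quadratic form of the Jacobian is nonnegative. -/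
open Real MeasureTheory RealInnerProductSpace

/-- The Fréchet derivative of the regularized drift. -/
lemma drift_hasFDerivAt (d : ℕ) (α κ ε : ℝ) (hε : 0 < ε) (x : EuclideanSpace ℝ (Fin d)) :
    ∃ L : EuclideanSpace ℝ (Fin d) →L[ℝ] EuclideanSpace ℝ (Fin d),
      HasFDerivAt (fun x : EuclideanSpace ℝ (Fin d) => (κ * (‖x‖ ^ 2 + ε) ^ (-(α / 2))) • x) L x ∧
      ∀ w, L w = (κ * (‖x‖ ^ 2 + ε) ^ (-(α / 2))) • w +
        (κ * (-(α / 2) * (‖x‖ ^ 2 + ε) ^ (-(α / 2) - 1) * (2 * inner ℝ x w))) • x := by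
  have hr : 0 < ‖x‖ ^ 2 + ε := by positivity
  have h1 := ((hasStrictFDerivAt_norm_sq x).hasFDerivAt.add_const ε)
  have h2 := ((h1.rpow_const (p := -(α / 2)) (Or.inl hr.ne')).const_mul κ).smul (hasFDerivAt_id x)
  refine ⟨_, h2, fun w => ?_⟩
  simp

/-- The regularized Hardy drift `b_ε(x) = κ(|x|²+ε)^{−α/2} x` is differentiable, and the
quadratic form of its Jacobian satisfies
`κ(1−α)|x|_ε^{−α}|w|² ≤ ⟨Db_ε(x)w, w⟩ ≤ κ|x|_ε^{−α}|w|²`. -/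
theorem jacobian_bounds_regularized_drift (d : ℕ) (hd : 3 ≤ d) (α κ ε : ℝ) (hα0 : 0 < α)
    (hα1 : α ≤ 1) (hκ : 0 < κ) (hε : 0 < ε) :
    Differentiable ℝ
        (fun x : EuclideanSpace ℝ (Fin d) => (κ * (‖x‖ ^ 2 + ε) ^ (-(α / 2))) • x) ∧
      ∀ x w : EuclideanSpace ℝ (Fin d),
        κ * (1 - α) * Real.sqrt (‖x‖ ^ 2 + ε) ^ (-α) * ‖w‖ ^ 2 ≤
            ⟪fderiv ℝ
                (fun x : EuclideanSpace ℝ (Fin d) => (κ * (‖x‖ ^ 2 + ε) ^ (-(α / 2))) • x)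
                x w, w⟫ ∧
          ⟪fderiv ℝ
              (fun x : EuclideanSpace ℝ (Fin d) => (κ * (‖x‖ ^ 2 + ε) ^ (-(α / 2))) • x)
              x w, w⟫ ≤ κ * Real.sqrt (‖x‖ ^ 2 + ε) ^ (-α) * ‖w‖ ^ 2 := by
  have key := drift_hasFDerivAt d α κ ε hε
  refine ⟨fun x => ?_, fun x w => ?_⟩
  · obtain ⟨L, hL, -⟩ := key x
    exact hL.differentiableAt
  · obtain ⟨L, hL, hw⟩ := key x
    rw [hL.fderiv, hw]
    have hr : 0 < ‖x‖ ^ 2 + ε := by positivity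
    have hs : Real.sqrt (‖x‖ ^ 2 + ε) ^ (-α) = (‖x‖ ^ 2 + ε) ^ (-(α / 2)) := by
      rw [Real.sqrt_eq_rpow, ← Real.rpow_mul hr.le]
      congr 1
      ring
    have hq : (‖x‖ ^ 2 + ε) ^ (-(α / 2)) = (‖x‖ ^ 2 + ε) ^ (-(α / 2) - 1) * (‖x‖ ^ 2 + ε) := by
      rw [Real.rpow_sub_one hr.ne']
      field_simp
    have hcs : (inner ℝ x w) ^ 2 ≤ ‖x‖ ^ 2 * ‖w‖ ^ 2 := by
      rw [← mul_pow]
      exact sq_le_sq.mpr (by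
        rw [abs_of_nonneg (by positivity : 0 ≤ ‖x‖ * ‖w‖)]
        exact abs_real_inner_le_norm x w)
    have hp : 0 < (‖x‖ ^ 2 + ε) ^ (-(α / 2) - 1) := Real.rpow_pos_of_pos hr _
    rw [hs, inner_add_left, real_inner_smul_left, real_inner_smul_left,
      real_inner_self_eq_norm_sq, hq]
    generalize (‖x‖ ^ 2 + ε) ^ (-(α / 2) - 1) = q at *
    generalize (inner ℝ x w : ℝ) = t at *
    have hc : 0 < κ * α * q := by positivity
    constructor
    · have h : 0 ≤ κ * α * q * ((‖x‖ ^ 2 + ε) * ‖w‖ ^ 2 - t ^ 2) := by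
        apply mul_nonneg hc.le
        nlinarith [mul_nonneg hε.le (sq_nonneg ‖w‖)]
      linarith
    · have h : 0 ≤ κ * α * q * t ^ 2 := by positivity
      linarith
end

section
/- Let d ≥ 3 be an integer, 0 < α ≤ 1, 0 < β < α, and s > 0. Define η : (0,∞) → ℝ by η(τ) = τ^β for 0 < τ < 1, η(τ) = βτ(2 − τ/2) + 1 − (3/2)β for 1 ≤ τ < 2, and η(τ) = 1 + β/2 for τ ≥ 2; let ψ_s(y) = η(s^{−1/α}|y|) (with ψ_s(0) = 0) and let ψ̃_s(y) = s^{−β/α}|y|^β. Then ψ̃_s − ψ_s is subharmonic in the sense of distributions: for every nonnegative φ ∈ C_c^∞(ℝ^d), ∫_{ℝ^d} ( ψ̃_s(x) − ψ_s(x) ) Δφ(x) dx ≥ 0. -/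
open Real MeasureTheory

/-- The profile `η` of the desingularizing weight. -/
noncomputable def eta (β τ : ℝ) : ℝ :=
  if τ < 1 then τ ^ β
  else if τ < 2 then β * τ * (2 - τ / 2) + 1 - 3 / 2 * β
  else 1 + β / 2

/-- The desingularizing weight `ψ_s(y) = η(s^{−1/α}|y|)` (equal to `0` at `y = 0`). -/
noncomputable def psiW (d : ℕ) (α β s : ℝ) (y : EuclideanSpace ℝ (Fin d)) : ℝ :=
  eta β (s ^ (-(1 / α)) * ‖y‖)

/-- The unbounded power weight `ψ̃_s(y) = s^{−β/α}|y|^β`. -/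
noncomputable def psiT (d : ℕ) (α β s : ℝ) (y : EuclideanSpace ℝ (Fin d)) : ℝ :=
  s ^ (-(β / α)) * ‖y‖ ^ β

/-- Pointwise Laplacian `Δf(x) = ∑ i ∂²_{x_i x_i} f(x)`. -/
noncomputable def lap {d : ℕ} (f : EuclideanSpace ℝ (Fin d) → ℝ)
    (x : EuclideanSpace ℝ (Fin d)) : ℝ :=
  ∑ i : Fin d,
    iteratedFDeriv ℝ 2 f x ![EuclideanSpace.single i 1, EuclideanSpace.single i 1]

lemma core_ibp {d : ℕ} (f k m : EuclideanSpace ℝ (Fin d) → ℝ) {C D : NNReal}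
    (hf : LipschitzWith C f) (hk : LipschitzWith D k)
    (h1 : ∀ᵐ x, ∀ v, lineDeriv ℝ f x v = k x * inner ℝ x v)
    (h2 : ∀ᵐ x, ∀ v, lineDeriv ℝ k x v = m x * inner ℝ x v)
    (h3 : ∀ᵐ x, 0 ≤ m x * ‖x‖ ^ 2 + d * k x)
    (φ : EuclideanSpace ℝ (Fin d) → ℝ) (hφ : ContDiff ℝ (⊤ : ℕ∞) φ) (hφc : HasCompactSupport φ)
    (hφ0 : ∀ x, 0 ≤ φ x) :
    0 ≤ ∫ x, f x * lap φ x := by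
  set e : Fin d → EuclideanSpace ℝ (Fin d) := fun i => EuclideanSpace.single i 1 with he
  set P : Fin d → EuclideanSpace ℝ (Fin d) → ℝ := fun i x => fderiv ℝ φ x (e i) with hP
  have hin : ∀ (x : EuclideanSpace ℝ (Fin d)) i, inner ℝ x (e i) = x i := by
    intro x i
    simp [he, EuclideanSpace.inner_single_right]
  have hfd : ContDiff ℝ (⊤ : ℕ∞) (fderiv ℝ φ) := hφ.fderiv_right (by simp)
  have hPs : ∀ i, ContDiff ℝ (⊤ : ℕ∞) (P i) := fun i => hfd.clm_apply contDiff_const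
  have hPc : ∀ i, HasCompactSupport (P i) := fun i => hφc.fderiv_apply ℝ (e i)
  have hlap : ∀ x, lap φ x = ∑ i, fderiv ℝ (P i) x (e i) := by
    intro x
    unfold lap
    refine Finset.sum_congr rfl fun i _ => ?_
    rw [iteratedFDeriv_two_apply]
    simp only [hP, Matrix.cons_val_zero, Matrix.cons_val_one]
    rw [fderiv_clm_apply (hfd.differentiable (by simp) x) (differentiableAt_const _)]
    simp [he]
  have hPd : ∀ i, ContDiff ℝ (⊤ : ℕ∞) (fun x => fderiv ℝ (P i) x (e i)) := fun i =>
    ((hPs i).fderiv_right (by simp)).clm_apply contDiff_const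
  have hPdc : ∀ i, HasCompactSupport (fun x => fderiv ℝ (P i) x (e i)) :=
    fun i => (hPc i).fderiv_apply ℝ (e i)
  have hx : ∀ i, ContDiff ℝ (⊤ : ℕ∞) (fun x : EuclideanSpace ℝ (Fin d) => x i) := by
    intro i; fun_prop
  -- first integration by parts
  have A : ∀ i, ∫ x, f x * fderiv ℝ (P i) x (e i) = - ∫ x, k x * x i * P i x := by
    intro i
    obtain ⟨L, hL⟩ := (hPs i).lipschitzWith_of_hasCompactSupport (hPc i) (by simp)
    have h := hf.integral_lineDeriv_mul_eq (μ := volume) hL (hPc i) (e i)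
    have e1 : ∫ x, lineDeriv ℝ f x (e i) * P i x = ∫ x, k x * x i * P i x := by
      apply integral_congr_ae
      filter_upwards [h1] with x hx
      rw [hx, hin]
    have e2 : ∫ x, lineDeriv ℝ (P i) x (-e i) * f x = - ∫ x, f x * fderiv ℝ (P i) x (e i) := by
      rw [← integral_neg]
      congr 1
      ext x
      rw [(((hPs i).differentiable (by simp)) x).lineDeriv_eq_fderiv]
      simp; ring
    rw [e1, e2] at h
    rw [h, neg_neg]
  have iKφ : Integrable (fun x => k x * φ x) :=
    (hk.continuous.mul hφ.continuous).integrable_of_hasCompactSupport hφc.mul_left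
  have iKP : ∀ i, Integrable (fun x => k x * x i * P i x) := fun i =>
    ((hk.continuous.mul (hx i).continuous).mul
      (hPs i).continuous).integrable_of_hasCompactSupport (hPc i).mul_left
  have iLd : ∀ i, Integrable (fun x => lineDeriv ℝ k x (e i) * (x i * φ x)) := by
    intro i
    have hi : Integrable (fun x : EuclideanSpace ℝ (Fin d) => x i * φ x) :=
      ((hx i).continuous.mul hφ.continuous).integrable_of_hasCompactSupport hφc.mul_left
    exact hi.bdd_mul (c := D * ‖e i‖) (aestronglyMeasurable_lineDeriv hk.continuous _)
      (.of_forall fun x => norm_lineDeriv_le_of_lipschitz ℝ hk)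
  -- second integration by parts
  have B : ∀ i, - ∫ x, k x * x i * P i x
      = ∫ x, (lineDeriv ℝ k x (e i) * (x i * φ x) + k x * φ x) := by
    intro i
    have hgs : ContDiff ℝ (⊤ : ℕ∞) (fun x : EuclideanSpace ℝ (Fin d) => x i * φ x) :=
      (hx i).mul hφ
    have hgc : HasCompactSupport (fun x : EuclideanSpace ℝ (Fin d) => x i * φ x) :=
      hφc.mul_left
    obtain ⟨L, hL⟩ := hgs.lipschitzWith_of_hasCompactSupport hgc (by simp)
    have h := hk.integral_lineDeriv_mul_eq (μ := volume) hL hgc (e i)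
    have e2 : ∫ x, lineDeriv ℝ (fun x : EuclideanSpace ℝ (Fin d) => x i * φ x) x (-e i) * k x
        = - (∫ x, k x * φ x) - ∫ x, k x * x i * P i x := by
      rw [← integral_neg, ← integral_sub iKφ.fun_neg (iKP i)]
      congr 1
      ext x
      rw [((hgs.differentiable (by simp)) x).lineDeriv_eq_fderiv]
      have hc : HasFDerivAt (fun x : EuclideanSpace ℝ (Fin d) => x i)
          (EuclideanSpace.proj i : EuclideanSpace ℝ (Fin d) →L[ℝ] ℝ) x :=
        (EuclideanSpace.proj i : EuclideanSpace ℝ (Fin d) →L[ℝ] ℝ).hasFDerivAt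
      have := (hc.fun_mul ((hφ.differentiable (by simp)) x).hasFDerivAt).fderiv
      rw [this]
      simp [hP, he]; ring
    rw [e2] at h
    rw [integral_add (iLd i) iKφ, h]
    ring
  have iF : ∀ i, Integrable (fun x => f x * fderiv ℝ (P i) x (e i)) := fun i =>
    (hf.continuous.mul (hPd i).continuous).integrable_of_hasCompactSupport (hPdc i).mul_left
  simp_rw [hlap, Finset.mul_sum]
  rw [integral_finsetSum _ (fun i _ => iF i)]
  simp_rw [A, B]
  rw [← integral_finsetSum _ (fun i _ => (iLd i).fun_add iKφ)]
  apply integral_nonneg_of_ae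
  filter_upwards [h2, h3] with x hx2 hx3
  have : ∑ i, (lineDeriv ℝ k x (e i) * (x i * φ x) + k x * φ x)
      = (m x * ‖x‖ ^ 2 + d * k x) * φ x := by
    simp_rw [hx2, hin, EuclideanSpace.norm_sq_eq, Real.norm_eq_abs, sq_abs]
    rw [Finset.sum_add_distrib, add_mul, Finset.mul_sum, Finset.sum_mul]
    simp
    congr 1
    swap
    · ring
    refine Finset.sum_congr rfl fun i _ => ?_
    ring
  show 0 ≤ _
  rw [this]
  exact mul_nonneg hx3 (hφ0 x)

lemma lineDeriv_radial {d : ℕ} (Q : ℝ → ℝ) (c a : ℝ) (x v : EuclideanSpace ℝ (Fin d))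
    (hx : x ≠ 0) (hQ : HasDerivAt Q a (c * ‖x‖)) :
    lineDeriv ℝ (fun x => Q (c * ‖x‖)) x v = a * c / ‖x‖ * inner ℝ x v := by
  have hn : HasFDerivAt (fun x : EuclideanSpace ℝ (Fin d) => ‖x‖)
      ((1 / ‖x‖) • innerSL ℝ x) x := by
    have h := (hasStrictFDerivAt_norm_sq x).hasFDerivAt.sqrt (by positivity)
    have h' : (fun x : EuclideanSpace ℝ (Fin d) => √(‖x‖ ^ 2)) = fun x => ‖x‖ := by
      ext y; simp
    rw [h'] at h
    refine h.congr_fderiv ?_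
    ext w
    simp
    field_simp
  have h : HasFDerivAt (fun x : EuclideanSpace ℝ (Fin d) => Q (c * ‖x‖)) _ x :=
    hQ.comp_hasFDerivAt x (hn.const_mul c)
  rw [(h.hasLineDerivAt v).lineDeriv]
  simp
  ring

lemma lip_max_rpow (p : ℝ) (hp : p ≤ 1) :
    LipschitzWith ‖p‖₊ (fun t : ℝ => (max 1 t) ^ p) := by
  have h : LipschitzOnWith ‖p‖₊ (fun t : ℝ => t ^ p) (Set.Ici 1) := by
    apply Convex.lipschitzOnWith_of_nnnorm_deriv_le (𝕜 := ℝ) (G := ℝ)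
    · intro x hx
      exact (Real.hasDerivAt_rpow_const (Or.inl (by simp at hx; positivity))).differentiableAt
    · intro x hx
      have hx' : (1:ℝ) ≤ x := hx
      rw [(Real.hasDerivAt_rpow_const (Or.inl (by positivity))).deriv]
      rw [nnnorm_mul]
      apply mul_le_of_le_one_right (zero_le)
      rw [← NNReal.coe_le_coe, coe_nnnorm, Real.norm_eq_abs, abs_of_nonneg (by positivity)]
      exact Real.rpow_le_one_of_one_le_of_nonpos hx' (by linarith)
    · exact convex_Ici 1
  have h2 : LipschitzWith 1 (fun t : ℝ => max 1 t) := LipschitzWith.id.const_max 1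
  have := h.comp (h2.lipschitzOnWith (s := Set.univ)) (fun x _ => le_max_left 1 x)
  rw [lipschitzOnWith_univ] at this
  rw [mul_one] at this
  exact this

noncomputable def FF (β t : ℝ) : ℝ :=
  (max 1 t) ^ β - 1 - β / 2 + β / 2 * (max (2 - max 1 t) 0) ^ 2

noncomputable def qq (β t : ℝ) : ℝ :=
  (max 1 t) ^ (β - 2) - max (2 * (max 1 t) ^ (-1 : ℝ) - 1) 0

noncomputable def FF' (β t : ℝ) : ℝ := β * t * qq β t

noncomputable def qq' (β t : ℝ) : ℝ :=
  if t < 1 then 0 else if t < 2 then (β - 2) * t ^ (β - 3) + 2 / t ^ 2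
  else (β - 2) * t ^ (β - 3)

lemma lip_FF (β : ℝ) (h0 : 0 < β) (h1 : β < 1) : ∃ C, LipschitzWith C (FF β) := by
  refine ⟨Real.toNNReal (2 * β), LipschitzWith.of_dist_le_mul fun x y => ?_⟩
  rw [Real.coe_toNNReal _ (by positivity)]
  have a := (lip_max_rpow β h1.le).dist_le_mul x y
  have b : LipschitzWith 1 (fun t : ℝ => max 1 t) := LipschitzWith.id.const_max 1
  have b1 := b.dist_le_mul x y
  have c1 : |max (2 - max 1 x) 0 - max (2 - max 1 y) 0| ≤ |max 1 x - max 1 y| := by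
    refine (abs_max_sub_max_le_abs _ _ _).trans ?_
    rw [abs_sub_comm]; ring_nf; rfl
  simp only [Real.dist_eq, coe_nnnorm, Real.norm_eq_abs, abs_of_pos h0, NNReal.coe_one,
    one_mul] at a b1 ⊢
  have c2 := c1.trans b1
  have d1 : 0 ≤ max (2 - max 1 x) 0 := le_max_right _ _
  have d2 : 0 ≤ max (2 - max 1 y) 0 := le_max_right _ _
  have d3 : max (2 - max 1 x) 0 ≤ 1 := max_le (by linarith [le_max_left 1 x]) (by norm_num)
  have d4 : max (2 - max 1 y) 0 ≤ 1 := max_le (by linarith [le_max_left 1 y]) (by norm_num)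
  unfold FF
  set u := max (2 - max 1 x) 0
  set w := max (2 - max 1 y) 0
  have e : |u ^ 2 - w ^ 2| ≤ 2 * |x - y| := by
    have : u ^ 2 - w ^ 2 = (u + w) * (u - w) := by ring
    rw [this, abs_mul, abs_of_nonneg (by positivity : 0 ≤ u + w)]
    exact mul_le_mul (by linarith) c2 (abs_nonneg _) (by norm_num)
  have : max 1 x ^ β - 1 - β / 2 + β / 2 * u ^ 2 - (max 1 y ^ β - 1 - β / 2 + β / 2 * w ^ 2)
    = (max 1 x ^ β - max 1 y ^ β) + β / 2 * (u ^ 2 - w ^ 2) := by ring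
  rw [this]
  refine (abs_add_le _ _).trans ?_
  rw [abs_mul, abs_of_pos (by positivity : 0 < β / 2)]
  nlinarith

lemma lip_qq (β : ℝ) (h1 : β < 1) : ∃ C, LipschitzWith C (qq β) := by
  have a := lip_max_rpow (β - 2) (by linarith)
  have b := lip_max_rpow (-1) (by norm_num)
  have b2 : LipschitzWith (2 * ‖(-1:ℝ)‖₊) (fun t : ℝ => 2 * (max 1 t) ^ (-1 : ℝ) - 1) := by
    apply LipschitzWith.of_dist_le_mul
    intro x y
    have := b.dist_le_mul x y
    simp only [Real.dist_eq, NNReal.coe_mul, NNReal.coe_ofNat] at this ⊢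
    rw [show 2 * max 1 x ^ (-1:ℝ) - 1 - (2 * max 1 y ^ (-1:ℝ) - 1)
      = 2 * (max 1 x ^ (-1:ℝ) - max 1 y ^ (-1:ℝ)) by ring, abs_mul]
    norm_num at this ⊢
    linarith
  exact ⟨_, a.sub (b2.max_const 0)⟩

lemma qq_lt {β t : ℝ} (ht : t ≤ 1) : qq β t = 0 := by
  unfold qq
  rw [max_eq_left ht]
  norm_num

lemma qq_mid {β t : ℝ} (h1 : 1 ≤ t) (h2 : t ≤ 2) : qq β t = t ^ (β - 2) - (2 / t - 1) := by
  unfold qq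
  rw [max_eq_right h1, max_eq_left, Real.rpow_neg_one]
  · rfl
  · rw [Real.rpow_neg_one, ← div_eq_mul_inv, sub_nonneg, le_div_iff₀ (by linarith)]; linarith

lemma qq_gt {β t : ℝ} (h2 : 2 ≤ t) : qq β t = t ^ (β - 2) := by
  unfold qq
  rw [max_eq_right (by linarith), max_eq_right, sub_zero]
  rw [Real.rpow_neg_one, ← div_eq_mul_inv, sub_nonpos, div_le_iff₀ (by linarith)]; linarith

lemma FF_lt {β t : ℝ} (ht : t ≤ 1) : FF β t = 0 := by
  unfold FF
  rw [max_eq_left ht]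
  norm_num

lemma FF_mid {β t : ℝ} (h1 : 1 ≤ t) (h2 : t ≤ 2) :
    FF β t = t ^ β - 1 - β / 2 + β / 2 * (2 - t) ^ 2 := by
  unfold FF
  rw [max_eq_right h1, max_eq_left (by linarith)]

lemma FF_gt {β t : ℝ} (h2 : 2 ≤ t) : FF β t = t ^ β - 1 - β / 2 := by
  unfold FF
  rw [max_eq_right (by linarith), max_eq_right (by linarith)]
  ring

lemma FF_eq {β t : ℝ} (hβ : 0 < β) (ht : 0 ≤ t) : t ^ β - eta β t = FF β t := by
  unfold eta
  split_ifs with h1 h2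
  · rw [FF_lt h1.le]; ring
  · rw [FF_mid (by linarith) h2.le]; ring
  · rw [FF_gt (by linarith)]; ring

lemma hasDeriv_FF {β t : ℝ} (h1 : t ≠ 1) (h2 : t ≠ 2) :
    HasDerivAt (FF β) (FF' β t) t := by
  unfold FF'
  rcases lt_or_gt_of_ne h1 with h | h
  · rw [qq_lt h.le, mul_zero]
    apply (hasDerivAt_const t (0:ℝ)).congr_of_eventuallyEq
    filter_upwards [Iio_mem_nhds h] with y hy using FF_lt (le_of_lt hy)
  have hr := Real.hasDerivAt_rpow_const (x := t) (p := β) (Or.inl (by positivity))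
  have ht0 : 0 < t := by linarith
  have hp : t * t ^ (β - 2) = t ^ (β - 1) := by
    rw [show β - 1 = 1 + (β - 2) by ring, Real.rpow_add ht0, Real.rpow_one]
  rcases lt_or_gt_of_ne h2 with h' | h'
  · rw [qq_mid h.le h'.le]
    have hd := ((hr.sub_const 1).sub_const (β / 2)).add
      ((((hasDerivAt_id t).const_sub 2).pow 2).const_mul (β / 2))
    refine HasDerivAt.congr_of_eventuallyEq (hd.congr_deriv ?_) ?_
    · simp only [id]
      rw [mul_assoc β t, mul_sub t, hp]
      field_simp
      ring
    · filter_upwards [Ioo_mem_nhds h h'] with y hy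
      rw [FF_mid hy.1.le hy.2.le]
      simp
  · rw [qq_gt h'.le, mul_assoc, hp]
    apply ((hr.sub_const 1).sub_const (β / 2)).congr_of_eventuallyEq
    filter_upwards [Ioi_mem_nhds h'] with y hy using FF_gt (le_of_lt hy)

lemma hasDeriv_qq {β t : ℝ} (h1 : t ≠ 1) (h2 : t ≠ 2) :
    HasDerivAt (qq β) (qq' β t) t := by
  unfold qq'
  rcases lt_or_gt_of_ne h1 with h | h
  · rw [if_pos h]
    apply (hasDerivAt_const t (0:ℝ)).congr_of_eventuallyEq
    filter_upwards [Iio_mem_nhds h] with y hy using qq_lt (le_of_lt hy)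
  rw [if_neg (by linarith)]
  have ht0 : 0 < t := by linarith
  have hr := Real.hasDerivAt_rpow_const (x := t) (p := β - 2) (Or.inl ht0.ne')
  rw [show β - 2 - 1 = β - 3 by ring] at hr
  rcases lt_or_gt_of_ne h2 with h' | h'
  · rw [if_pos h']
    have hd := hr.sub (((hasDerivAt_inv ht0.ne').const_mul 2).sub_const 1)
    refine HasDerivAt.congr_of_eventuallyEq (hd.congr_deriv ?_) ?_
    · field_simp
      ring
    · filter_upwards [Ioo_mem_nhds h h'] with y hy
      rw [qq_mid hy.1.le hy.2.le]
      simp [div_eq_mul_inv]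
  · rw [if_neg (by linarith)]
    apply hr.congr_of_eventuallyEq
    filter_upwards [Ioi_mem_nhds h'] with y hy using qq_gt (le_of_lt hy)

lemma key_ineq {β t : ℝ} {d : ℕ} (hd : 3 ≤ d) (h0 : 0 < β) (hb : β < 1) :
    0 ≤ t * qq' β t + d * qq β t := by
  have hd' : (3:ℝ) ≤ d := by exact_mod_cast hd
  unfold qq'
  split_ifs with h1 h2
  · rw [qq_lt h1.le]; simp
  · have ht : 1 ≤ t := not_lt.1 h1
    have ht0 : 0 < t := by linarith
    rw [qq_mid ht h2.le]
    have hp : t ^ (β - 2) = t ^ (β - 1) / t := by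
      rw [show β - 2 = (β - 1) - 1 by ring, Real.rpow_sub_one ht0.ne']
    have hp3 : t ^ (β - 3) = t ^ (β - 1) / t / t := by
      rw [show β - 3 = (β - 1) - 1 - 1 by ring, Real.rpow_sub_one ht0.ne',
        Real.rpow_sub_one ht0.ne']
    rw [hp, hp3]
    have hB : 1 + (β - 1) * (t - 1) ≤ t ^ (β - 1) := by
      rw [Real.rpow_def_of_pos ht0]
      have := Real.add_one_le_exp (Real.log t * (β - 1))
      have := Real.log_le_sub_one_of_pos ht0
      nlinarith
    set y := t ^ (β - 1)
    have : t * ((β - 2) * (y / t / t) + 2 / t ^ 2) + d * (y / t - (2 / t - 1))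
        = ((d - 2 + β) * y + d * t - 2 * (d - 1)) / t := by
      field_simp; ring
    rw [this]
    apply div_nonneg _ ht0.le
    have h5 : (d - 2 + β) * (1 + (β - 1) * (t - 1)) ≤ (d - 2 + β) * y :=
      mul_le_mul_of_nonneg_left hB (by linarith)
    have h6 : 0 ≤ (t - 1) * (d - (d - 2 + β) * (1 - β)) := by
      apply mul_nonneg (by linarith)
      nlinarith
    nlinarith
  · have ht : 2 ≤ t := not_lt.1 h2
    have ht0 : 0 < t := by linarith
    rw [qq_gt ht]
    have hp : t ^ (β - 2) = t * t ^ (β - 3) := by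
      rw [show β - 2 = 1 + (β - 3) by ring, Real.rpow_add ht0, Real.rpow_one]
    rw [hp]
    have : 0 < t * t ^ (β - 3) := by positivity
    nlinarith

/-- `ψ̃_s − ψ_s` is subharmonic in the sense of distributions: for every nonnegative test
function `φ ∈ C_c^∞`, `∫ (ψ̃_s − ψ_s) Δφ ≥ 0`. -/
theorem psiT_sub_psiW_subharmonic (d : ℕ) (hd : 3 ≤ d) (α β s : ℝ) (hα0 : 0 < α)
    (hα1 : α ≤ 1) (hβ0 : 0 < β) (hβα : β < α) (hs : 0 < s)
    (φ : EuclideanSpace ℝ (Fin d) → ℝ) (hφ : ContDiff ℝ (⊤ : ℕ∞) φ) (hφc : HasCompactSupport φ)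
    (hφ0 : ∀ x, 0 ≤ φ x) :
    0 ≤ ∫ x : EuclideanSpace ℝ (Fin d), (psiT d α β s x - psiW d α β s x) * lap φ x := by
  have hβ1 : β < 1 := by linarith
  set c : ℝ := s ^ (-(1 / α)) with hc
  have hc0 : 0 < c := by positivity
  have hfun : ∀ x, psiT d α β s x - psiW d α β s x = FF β (c * ‖x‖) := by
    intro x
    unfold psiT psiW
    rw [← hc, ← FF_eq hβ0 (by positivity), Real.mul_rpow hc0.le (norm_nonneg x), hc,
      ← Real.rpow_mul hs.le]
    congr 3
    ring
  simp_rw [hfun]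
  have lipn : LipschitzWith ⟨c, hc0.le⟩ (fun x : EuclideanSpace ℝ (Fin d) => c * ‖x‖) := by
    apply LipschitzWith.of_dist_le_mul
    intro x y
    rw [Real.dist_eq, ← mul_sub, abs_mul, abs_of_pos hc0, dist_eq_norm]
    exact mul_le_mul_of_nonneg_left (abs_norm_sub_norm_le x y) hc0.le
  obtain ⟨C1, hC1⟩ := lip_FF β hβ0 hβ1
  obtain ⟨C2, hC2⟩ := lip_qq β hβ1
  have hae : ∀ᵐ x : EuclideanSpace ℝ (Fin d), x ≠ 0 ∧ c * ‖x‖ ≠ 1 ∧ c * ‖x‖ ≠ 2 := by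
    haveI : NeZero d := ⟨by omega⟩
    have hsph : ∀ r : ℝ, ∀ᵐ x : EuclideanSpace ℝ (Fin d), ‖x‖ ≠ r := by
      intro r
      have := Measure.addHaar_sphere (volume : Measure (EuclideanSpace ℝ (Fin d))) 0 r
      rw [ae_iff]
      convert this using 2
      ext x; simp
    filter_upwards [hsph 0, hsph (1 / c), hsph (2 / c)] with x h0 h1 h2
    refine ⟨by simpa using h0, fun h => h1 ?_, fun h => h2 ?_⟩
    · field_simp; linarith
    · field_simp; linarith
  have lipk : LipschitzWith (‖c ^ 2 * β‖₊ * (C2 * ⟨c, hc0.le⟩))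
      (fun x : EuclideanSpace ℝ (Fin d) => (c ^ 2 * β) * qq β (c * ‖x‖)) :=
    (lipschitzWith_smul (c ^ 2 * β)).comp (hC2.comp lipn)
  refine core_ibp (fun x => FF β (c * ‖x‖)) (fun x => (c ^ 2 * β) * qq β (c * ‖x‖))
    (fun x => (c ^ 2 * β * qq' β (c * ‖x‖)) * c / ‖x‖) (hC1.comp lipn) lipk ?_ ?_ ?_ φ hφ hφc hφ0
  · filter_upwards [hae] with x hx v
    rw [lineDeriv_radial _ c _ x v hx.1 (hasDeriv_FF hx.2.1 hx.2.2)]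
    have : ‖x‖ ≠ 0 := by simpa using hx.1
    unfold FF'
    field_simp
  · filter_upwards [hae] with x hx v
    exact lineDeriv_radial (fun t => (c ^ 2 * β) * qq β t) c _ x v hx.1
      ((hasDeriv_qq hx.2.1 hx.2.2).const_mul _)
  · filter_upwards [hae] with x hx
    have hn : ‖x‖ ≠ 0 := by simpa using hx.1
    have := key_ineq (t := c * ‖x‖) hd hβ0 hβ1
    have e : c ^ 2 * β * qq' β (c * ‖x‖) * c / ‖x‖ * ‖x‖ ^ 2 + d * (c ^ 2 * β * qq β (c * ‖x‖))
      = c ^ 2 * β * (c * ‖x‖ * qq' β (c * ‖x‖) + d * qq β (c * ‖x‖)) := by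
      field_simp
    rw [e]
    positivity
end

section
/- Let d ≥ 3 be an integer, 0 < α ≤ 1, 0 < β < α, and s > 0. Define η : (0,∞) → ℝ by η(τ) = τ^β for 0 < τ < 1, η(τ) = βτ(2 − τ/2) + 1 − (3/2)β for 1 ≤ τ < 2, and η(τ) = 1 + β/2 for τ ≥ 2; let ψ_s(y) = η(s^{−1/α}|y|) (with ψ_s(0) = 0). Then for every x ∈ ℝ^d with x ≠ 0, the function y ↦ |x−y|^{2−α−d} Δψ_s(y) (with Δψ_s the pointwise Laplacian, defined off the null set {0} ∪ {|y| = s^{1/α}} ∪ {|y| = 2 s^{1/α}}) is Lebesgue integrable on ℝ^d, and − (1/γ(2−α)) ∫_{ℝ^d} |x−y|^{2−α−d} Δψ_s(y) dy ≥ − β(d+β−2) ( γ(d+β−2)/γ(d+β−α) ) s^{−β/α} |x|^{β−α}. -/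
open Real MeasureTheory

/-- `γ(s) = 2^s π^{d/2} Γ(s/2) / Γ((d−s)/2)`, for an integer `d` and `s ∈ ℝ`. -/
noncomputable def gam (d : ℕ) (s : ℝ) : ℝ :=
  2 ^ s * Real.pi ^ ((d : ℝ) / 2) * Real.Gamma (s / 2) / Real.Gamma (((d : ℝ) - s) / 2)

lemma lint_gamma {p c : ℝ} (hp : 0 < p) (hc : 0 < c) :
    ∫⁻ t in Set.Ioi (0:ℝ), ENNReal.ofReal (t ^ (p - 1) * rexp (-(c * t)))
      = ENNReal.ofReal (Real.Gamma p * c ^ (-p)) := by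
  rw [← ofReal_integral_eq_lintegral_ofReal]
  · rw [Real.integral_rpow_mul_exp_neg_mul_Ioi hp hc]
    congr 1
    rw [one_div, Real.inv_rpow hc.le, Real.rpow_neg hc.le, mul_comm]
  · have := integrableOn_rpow_mul_exp_neg_mul_rpow (p := 1) (s := p - 1) (by linarith) one_pos hc
    simpa [IntegrableOn] using this
  · filter_upwards [ae_restrict_mem measurableSet_Ioi] with t ht
    have : 0 < t := ht
    simp only [Pi.zero_apply]
    positivity

lemma lint_beta {P Q : ℝ} (hP : 0 < P) (hQ : 0 < Q) :
    ∫⁻ v in Set.Ioi (0:ℝ), ENNReal.ofReal (v ^ (P - 1) * (1 + v) ^ (-(P + Q)))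
      = ENNReal.ofReal (Real.Gamma P * Real.Gamma Q / Real.Gamma (P + Q)) := by
  have hG : 0 < Real.Gamma (P + Q) := Real.Gamma_pos_of_pos (by linarith)
  have h1 : ∀ v ∈ Set.Ioi (0:ℝ), ENNReal.ofReal (v ^ (P - 1) * (1 + v) ^ (-(P + Q)))
      = ENNReal.ofReal (Real.Gamma (P + Q))⁻¹ * ∫⁻ w in Set.Ioi (0:ℝ),
        ENNReal.ofReal (v ^ (P - 1) * (w ^ (P + Q - 1) * rexp (-((1 + v) * w)))) := by
    intro v hv
    have hv : 0 < v := hv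
    simp_rw [ENNReal.ofReal_mul (Real.rpow_nonneg hv.le _)]
    rw [lintegral_const_mul' _ _ ENNReal.ofReal_ne_top]
    simp_rw [← ENNReal.ofReal_mul (Real.rpow_nonneg hv.le _)]
    rw [lint_gamma (by linarith) (by linarith), ← ENNReal.ofReal_mul (by positivity),
      ← ENNReal.ofReal_mul (by positivity)]
    congr 1
    field_simp
  rw [setLIntegral_congr_fun measurableSet_Ioi h1, lintegral_const_mul' _ _ ENNReal.ofReal_ne_top,
    lintegral_lintegral_swap (by fun_prop)]
  have h2 : ∀ w ∈ Set.Ioi (0:ℝ), ∫⁻ v in Set.Ioi (0:ℝ),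
        ENNReal.ofReal (v ^ (P - 1) * (w ^ (P + Q - 1) * rexp (-((1 + v) * w))))
      = ENNReal.ofReal (Real.Gamma P) * ENNReal.ofReal (w ^ (Q - 1) * rexp (-(1 * w))) := by
    intro w hw
    have hw : 0 < w := hw
    have : ∀ v : ℝ, v ^ (P - 1) * (w ^ (P + Q - 1) * rexp (-((1 + v) * w)))
        = (w ^ (P + Q - 1) * rexp (-w)) * (v ^ (P - 1) * rexp (-(w * v))) := by
      intro v
      rw [show -((1 + v) * w) = -w + -(w * v) by ring, Real.exp_add]; ring
    simp_rw [this]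
    simp_rw [ENNReal.ofReal_mul (show 0 ≤ w ^ (P + Q - 1) * rexp (-w) by positivity)]
    rw [lintegral_const_mul' _ _ ENNReal.ofReal_ne_top, lint_gamma hP hw,
      ← ENNReal.ofReal_mul (by positivity),
      ← ENNReal.ofReal_mul (Real.Gamma_pos_of_pos hP).le]
    congr 1
    rw [show Q - 1 = (P + Q - 1) + -P by ring, Real.rpow_add hw, one_mul]; ring
  rw [setLIntegral_congr_fun measurableSet_Ioi h2, lintegral_const_mul' _ _ ENNReal.ofReal_ne_top,
    lint_gamma hQ one_pos, ← ENNReal.ofReal_mul (Real.Gamma_pos_of_pos hP).le,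
      ← ENNReal.ofReal_mul (by positivity)]
  congr 1
  simp; ring

lemma lint_gauss {d : ℕ} (x : EuclideanSpace ℝ (Fin d)) {t u : ℝ} (ht : 0 < t) (hu : 0 < u) :
    ∫⁻ y : EuclideanSpace ℝ (Fin d), ENNReal.ofReal (rexp (-(t * ‖x - y‖ ^ 2 + u * ‖y‖ ^ 2)))
      = ENNReal.ofReal ((π / (t + u)) ^ ((d : ℝ) / 2) * rexp (-(t * u / (t + u) * ‖x‖ ^ 2))) := by
  have h : ∀ y : EuclideanSpace ℝ (Fin d), rexp (-(t * ‖x - y‖ ^ 2 + u * ‖y‖ ^ 2)) =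
      rexp (-(t * u / (t + u) * ‖x‖ ^ 2)) * rexp (-(t+u) * ‖y - (t / (t + u)) • x‖ ^ 2) := by
    intro y
    rw [← Real.exp_add]
    congr 1
    rw [norm_sub_sq_real, norm_sub_sq_real, norm_smul, inner_smul_right, real_inner_comm x y,
      mul_pow, Real.norm_eq_abs, sq_abs]
    field_simp
    ring
  simp_rw [h, ENNReal.ofReal_mul (Real.exp_pos _).le]
  rw [lintegral_const_mul' _ _ ENNReal.ofReal_ne_top,
    lintegral_sub_right_eq_self (fun y : EuclideanSpace ℝ (Fin d) => ENNReal.ofReal (rexp (-(t+u) * ‖y‖ ^ 2)))]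
  have hI := GaussianFourier.integral_rexp_neg_mul_sq_norm (V := EuclideanSpace ℝ (Fin d)) (b := t + u) (by linarith)
  have hint : Integrable (fun y : EuclideanSpace ℝ (Fin d) => rexp (-(t+u) * ‖y‖ ^ 2)) := by
    by_contra hc
    rw [integral_undef hc] at hI
    have : 0 < (π / (t + u)) ^ ((Module.finrank ℝ (EuclideanSpace ℝ (Fin d)) : ℝ) / 2) := by positivity
    linarith
  rw [← ofReal_integral_eq_lintegral_ofReal hint (Filter.Eventually.of_forall fun _ => (Real.exp_pos _).le), hI,
    ← ENNReal.ofReal_mul (Real.exp_pos _).le]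
  congr 1
  simp [mul_comm]

lemma lint_riesz {d : ℕ} (hd : 3 ≤ d) (x : EuclideanSpace ℝ (Fin d)) (hx : x ≠ 0) {p q : ℝ}
    (hp : 0 < p) (hq : 0 < q) (hpd : p < d / 2) (hqd : q < d / 2) (hpq : (d:ℝ) / 2 < p + q) :
    ∫⁻ y : EuclideanSpace ℝ (Fin d), ENNReal.ofReal (‖x - y‖ ^ (-(2 * p)) * ‖y‖ ^ (-(2 * q)))
      = ENNReal.ofReal (π ^ ((d:ℝ)/2) * Real.Gamma (p + q - d / 2) * Real.Gamma (d / 2 - p)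
          * Real.Gamma (d / 2 - q) / (Real.Gamma p * Real.Gamma q * Real.Gamma (d - p - q))
          * ‖x‖ ^ (-(2 * (p + q - d / 2)))) := by
  have hGp := Real.Gamma_pos_of_pos hp
  have hGq := Real.Gamma_pos_of_pos hq
  have hR : 0 < ‖x‖ := norm_pos_iff.2 hx
  have : Nontrivial (EuclideanSpace ℝ (Fin d)) := ⟨x, 0, hx⟩
  have h1 : ∀ᵐ y : EuclideanSpace ℝ (Fin d), 
      ENNReal.ofReal (‖x - y‖ ^ (-(2 * p)) * ‖y‖ ^ (-(2 * q))) =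
      ENNReal.ofReal (Real.Gamma p * Real.Gamma q)⁻¹ * 
      ∫⁻ v in Set.Ioi (0:ℝ), ∫⁻ u in Set.Ioi (0:ℝ), 
        ENNReal.ofReal (v ^ (p - 1) * u ^ (p + q - 1) * rexp (-(u * v * ‖x - y‖ ^ 2 + u * ‖y‖ ^ 2))) := by
    filter_upwards [Measure.ae_ne volume x, Measure.ae_ne volume (0 : EuclideanSpace ℝ (Fin d))] with y hy hy0
    have hr : 0 < ‖x - y‖ := norm_pos_iff.2 (sub_ne_zero.2 hy.symm)
    have hr0 : 0 < ‖y‖ := norm_pos_iff.2 hy0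
    rw [lintegral_lintegral_swap (by fun_prop)]
    have h2 : ∀ u ∈ Set.Ioi (0:ℝ), ∫⁻ v in Set.Ioi (0:ℝ),
          ENNReal.ofReal (v ^ (p - 1) * u ^ (p + q - 1) * rexp (-(u * v * ‖x - y‖ ^ 2 + u * ‖y‖ ^ 2)))
        = ENNReal.ofReal (Real.Gamma p * ‖x - y‖ ^ (-(2 * p))) * 
          ENNReal.ofReal (u ^ (q - 1) * rexp (-(‖y‖ ^ 2 * u))) := by
      intro u hu
      have hu : 0 < u := hu
      have : ∀ v : ℝ, v ^ (p - 1) * u ^ (p + q - 1) * rexp (-(u * v * ‖x - y‖ ^ 2 + u * ‖y‖ ^ 2))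
          = (u ^ (p + q - 1) * rexp (-(‖y‖ ^ 2 * u))) * (v ^ (p - 1) * rexp (-((u * ‖x - y‖ ^ 2) * v))) := by
        intro v
        rw [show -(u * v * ‖x - y‖ ^ 2 + u * ‖y‖ ^ 2) = -(‖y‖ ^ 2 * u) + -((u * ‖x - y‖ ^ 2) * v) by ring, Real.exp_add]; ring
      simp_rw [this]
      simp_rw [ENNReal.ofReal_mul (show 0 ≤ u ^ (p + q - 1) * rexp (-(‖y‖ ^ 2 * u)) by positivity)]
      rw [lintegral_const_mul' _ _ ENNReal.ofReal_ne_top, lint_gamma hp (by positivity),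
        ← ENNReal.ofReal_mul (by positivity),
        ← ENNReal.ofReal_mul (by positivity)]
      congr 1
      rw [show q - 1 = (p + q - 1) + -p by ring, Real.rpow_add hu, Real.mul_rpow hu.le (by positivity),
        ← Real.rpow_natCast ‖x - y‖ 2, ← Real.rpow_mul hr.le]
      push_cast
      rw [show 2 * -p = -(2 * p) by ring]; ring
    rw [setLIntegral_congr_fun measurableSet_Ioi h2, lintegral_const_mul' _ _ ENNReal.ofReal_ne_top,
      lint_gamma hq (by positivity), ← ENNReal.ofReal_mul (by positivity),
      ← ENNReal.ofReal_mul (by positivity)]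
    congr 1
    rw [← Real.rpow_natCast ‖y‖ 2, ← Real.rpow_mul hr0.le]
    push_cast
    rw [show 2 * -q = -(2 * q) by ring]
    field_simp
  rw [lintegral_congr_ae h1, lintegral_const_mul' _ _ ENNReal.ofReal_ne_top,
    lintegral_lintegral_swap]
  swap
  · refine AEMeasurable.lintegral_prod_right' (f := fun z : (EuclideanSpace ℝ (Fin d) × ℝ) × ℝ =>
      ENNReal.ofReal (z.1.2 ^ (p - 1) * z.2 ^ (p + q - 1) * 
        rexp (-(z.2 * z.1.2 * ‖x - z.1.1‖ ^ 2 + z.2 * ‖z.1.1‖ ^ 2)))) ?_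
    fun_prop
  have hm : 0 < p + q - d / 2 := by linarith
  have hGm := Real.Gamma_pos_of_pos hm
  have h3 : ∀ v ∈ Set.Ioi (0:ℝ), ∫⁻ y : EuclideanSpace ℝ (Fin d), ∫⁻ u in Set.Ioi (0:ℝ), 
        ENNReal.ofReal (v ^ (p - 1) * u ^ (p + q - 1) * rexp (-(u * v * ‖x - y‖ ^ 2 + u * ‖y‖ ^ 2)))
      = ENNReal.ofReal (π ^ ((d:ℝ)/2) * Real.Gamma (p + q - d / 2) * ‖x‖ ^ (-(2 * (p + q - d / 2)))) *
        ENNReal.ofReal (v ^ ((d / 2 - q) - 1) * (1 + v) ^ (-((d / 2 - q) + (d / 2 - p)))) := by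
    intro v hv
    have hv : 0 < v := hv
    rw [lintegral_lintegral_swap (by fun_prop)]
    have h4 : ∀ u ∈ Set.Ioi (0:ℝ), ∫⁻ y : EuclideanSpace ℝ (Fin d), 
        ENNReal.ofReal (v ^ (p - 1) * u ^ (p + q - 1) * rexp (-(u * v * ‖x - y‖ ^ 2 + u * ‖y‖ ^ 2)))
        = ENNReal.ofReal (v ^ (p - 1) * π ^ ((d:ℝ)/2) * (1 + v) ^ (-((d:ℝ)/2))) * 
          ENNReal.ofReal (u ^ ((p + q - d / 2) - 1) * rexp (-((v / (1 + v) * ‖x‖ ^ 2) * u))) := by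
      intro u hu
      have hu : 0 < u := hu
      simp_rw [ENNReal.ofReal_mul (show 0 ≤ v ^ (p - 1) * u ^ (p + q - 1) by positivity)]
      rw [lintegral_const_mul' _ _ ENNReal.ofReal_ne_top, lint_gauss x (by positivity) hu,
        ← ENNReal.ofReal_mul (by positivity),
        ← ENNReal.ofReal_mul (by positivity)]
      congr 1
      rw [show u * v * u / (u * v + u) * ‖x‖ ^ 2 = (v / (1 + v) * ‖x‖ ^ 2) * u by field_simp; ring,
        show u * v + u = u * (1 + v) by ring, Real.div_rpow Real.pi_pos.le (by positivity),
        Real.mul_rpow hu.le (by positivity), show (p + q - d / 2) - 1 = (p + q - 1) - d / 2 by ring,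
        Real.rpow_sub hu (p + q - 1) (d / 2), Real.rpow_neg (by positivity)]
      simp only [div_eq_mul_inv, mul_inv]
      ring
    rw [setLIntegral_congr_fun measurableSet_Ioi h4, lintegral_const_mul' _ _ ENNReal.ofReal_ne_top,
      lint_gamma hm (by positivity), ← ENNReal.ofReal_mul (by positivity),
      ← ENNReal.ofReal_mul (by positivity)]
    congr 1
    have e1 : (v / (1 + v) * ‖x‖ ^ 2) ^ (-(p + q - (d:ℝ) / 2)) = 
        v ^ (-(p + q - (d:ℝ) / 2)) * (1 + v) ^ (p + q - (d:ℝ) / 2) * ‖x‖ ^ (-(2 * (p + q - (d:ℝ) / 2))) := by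
      rw [Real.mul_rpow (by positivity) (by positivity), Real.div_rpow hv.le (by positivity),
        ← Real.rpow_natCast ‖x‖ 2, ← Real.rpow_mul hR.le, Real.rpow_neg (show 0 ≤ 1 + v by positivity)]
      push_cast
      rw [show 2 * -(p + q - (d:ℝ) / 2) = -(2 * (p + q - (d:ℝ) / 2)) by ring, div_inv_eq_mul]
    rw [e1, show (d:ℝ) / 2 - q - 1 = (p - 1) + (-(p + q - d/2)) by ring, Real.rpow_add hv,
      show -((d:ℝ) / 2 - q + (d / 2 - p)) = -(d/2) + (p + q - d/2) by ring, 
      Real.rpow_add (show 0 < 1 + v by positivity)]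
    ring
  rw [setLIntegral_congr_fun measurableSet_Ioi h3, lintegral_const_mul' _ _ ENNReal.ofReal_ne_top,
    lint_beta (by linarith) (by linarith), ← ENNReal.ofReal_mul (by positivity),
      ← ENNReal.ofReal_mul (by positivity)]
  congr 1
  rw [show (d:ℝ) / 2 - q + (d / 2 - p) = d - p - q by ring]
  field_simp

lemma lap_radial {d : ℕ} (x : EuclideanSpace ℝ (Fin d)) (hx : x ≠ 0)
    (f : EuclideanSpace ℝ (Fin d) → ℝ) (A B C p : ℝ)
    (hf : f =ᶠ[nhds x] fun y => A * (‖y‖ ^ 2) ^ p + B * ‖y‖ ^ 2 + C) :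
    lap f x = A * (4 * p * (p - 1) + 2 * d * p) * (‖x‖ ^ 2) ^ (p - 1) + 2 * d * B := by
  have key : ∀ v, iteratedFDeriv ℝ 2 f x ![v, v] =
      4 * A * p * (p - 1) * (‖x‖ ^ 2) ^ (p - 2) * (inner ℝ x v) ^ 2
        + (2 * A * p * (‖x‖ ^ 2) ^ (p - 1) + 2 * B) * ‖v‖ ^ 2 := by
    intro v
    rw [iteratedFDeriv_two_apply]
    have h1 : fderiv ℝ f =ᶠ[nhds x] fun y => (2 * A * p * (‖y‖ ^ 2) ^ (p - 1) + 2 * B) • innerSL ℝ y := by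
      filter_upwards [hf.fderiv (𝕜 := ℝ), isOpen_ne.mem_nhds hx] with y hy hy0
      rw [hy]
      have hy0 : 0 < ‖y‖ := norm_pos_iff.2 hy0
      have h2 : HasFDerivAt (fun y : EuclideanSpace ℝ (Fin d) => ‖y‖ ^ 2) (2 • innerSL ℝ y) y :=
        (hasStrictFDerivAt_norm_sq y).hasFDerivAt
      have h3 : HasFDerivAt (fun y : EuclideanSpace ℝ (Fin d) => A * (‖y‖ ^ 2) ^ p + B * ‖y‖ ^ 2 + C) _ y :=
        (((h2.rpow_const (p := p) (Or.inl (by positivity))).const_mul A).add (h2.const_mul B)).add_const C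
      rw [h3.fderiv]
      ext w
      simp
      ring
    rw [h1.fderiv_eq]
    have hx0 : 0 < ‖x‖ := norm_pos_iff.2 hx
    have h2 : HasFDerivAt (fun y : EuclideanSpace ℝ (Fin d) => ‖y‖ ^ 2) (2 • innerSL ℝ x) x :=
        (hasStrictFDerivAt_norm_sq x).hasFDerivAt
    have h4 : HasFDerivAt (fun y : EuclideanSpace ℝ (Fin d) => innerSL ℝ y) (innerSL ℝ) x :=
      (innerSL ℝ (E := EuclideanSpace ℝ (Fin d))).hasFDerivAt
    have h3 : HasFDerivAt (fun y : EuclideanSpace ℝ (Fin d) => (2 * A * p * (‖y‖ ^ 2) ^ (p - 1) + 2 * B) • innerSL ℝ y) _ x := 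
      (((h2.rpow_const (p := p - 1) (Or.inl (by positivity))).const_mul (2 * A * p)).add_const (2 * B)).smul h4
    rw [h3.fderiv]
    have hvv : (innerSL ℝ v) v = ‖v‖ ^ 2 := by rw [innerSL_apply_apply, real_inner_self_eq_norm_sq]
    simp [hvv]
    rw [show p - 1 - 1 = p - 2 by ring]
    ring
  unfold lap
  simp_rw [key]
  have hx0 : 0 < ‖x‖ ^ 2 := by have := norm_pos_iff.2 hx; positivity
  rw [Finset.sum_add_distrib, ← Finset.mul_sum]
  have : ∑ i : Fin d, (inner ℝ x (EuclideanSpace.single i 1)) ^ 2 = ‖x‖ ^ 2 := by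
    rw [EuclideanSpace.norm_sq_eq]
    simp [EuclideanSpace.inner_single_right]
  rw [this]
  simp
  rw [show p - 1 = p - 2 + 1 by ring, Real.rpow_add hx0, Real.rpow_one]
  ring

lemma psi_near {d : ℕ} (α β s : ℝ) (hs : 0 < s) (hβ0 : 0 < β) (y : EuclideanSpace ℝ (Fin d)) (hy : y ≠ 0)
    (l : ℝ) (hl : l = s ^ (-(1 / α))) (h1 : l * ‖y‖ ≠ 1) (h2 : l * ‖y‖ ≠ 2) :
    lap (psiW d α β s) y = if l * ‖y‖ < 1 then β * (d + β - 2) * l ^ β * ‖y‖ ^ (β - 2)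
      else if l * ‖y‖ < 2 then 2 * β * (d - 1) * l * ‖y‖⁻¹ - d * β * l ^ 2 else 0 := by
  have hl0 : 0 < l := by rw [hl]; positivity
  have hy0 : 0 < ‖y‖ := norm_pos_iff.2 hy
  have hc : ContinuousAt (fun z : EuclideanSpace ℝ (Fin d) => l * ‖z‖) y := by fun_prop
  split_ifs with c1 c2
  · rw [lap_radial y hy _ (l ^ β) 0 0 (β / 2)]
    · rw [← Real.rpow_natCast ‖y‖ 2, ← Real.rpow_mul hy0.le]
      push_cast
      rw [show 2 * (β / 2 - 1) = β - 2 by ring]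
      ring
    · filter_upwards [hc.eventually_lt_const c1] with z hz
      unfold psiW eta
      rw [← hl, if_pos hz, Real.mul_rpow hl0.le (norm_nonneg _), ← Real.rpow_natCast ‖z‖ 2, ← Real.rpow_mul (norm_nonneg _)]
      push_cast
      rw [show 2 * (β / 2) = β by ring]
      ring
  · have c1' : 1 < l * ‖y‖ := lt_of_le_of_ne (not_lt.1 c1) (Ne.symm h1)
    rw [lap_radial y hy _ (2 * β * l) (- (β * l ^ 2 / 2)) (1 - 3 / 2 * β) (1 / 2)]
    · rw [← Real.rpow_natCast ‖y‖ 2, ← Real.rpow_mul hy0.le]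
      push_cast
      rw [show (2 * (1 / 2 - 1) : ℝ) = -1 by norm_num, Real.rpow_neg_one]
      ring
    · filter_upwards [hc.eventually_lt_const c2, hc.eventually_const_lt c1'] with z hz hz'
      unfold psiW eta
      rw [← hl, if_neg (not_lt.2 hz'.le), if_pos hz, ← Real.sqrt_eq_rpow, Real.sqrt_sq (norm_nonneg _)]
      ring
  · have c2' : 2 < l * ‖y‖ := lt_of_le_of_ne (not_lt.1 c2) (Ne.symm h2)
    rw [lap_radial y hy _ 0 0 (1 + β / 2) 1]
    · simp
    · filter_upwards [hc.eventually_const_lt c2'] with z hz'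
      unfold psiW eta
      rw [← hl, if_neg (by linarith), if_neg (by linarith)]
      ring

lemma profile_bound {d β l r : ℝ} (hd : 3 ≤ d) (hβ0 : 0 < β) (hl : 0 < l) (hr : 0 < r)
    (F : ℝ) (hF : F = if l * r < 1 then β * (d + β - 2) * l ^ β * r ^ (β - 2)
      else if l * r < 2 then 2 * β * (d - 1) * l * r⁻¹ - d * β * l ^ 2 else 0) :
    F ≤ β * (d + β - 2) * l ^ β * r ^ (β - 2) ∧ |F| ≤ 4 * (β * (d + β - 2) * l ^ β * r ^ (β - 2)) := by
  have hd2 : 0 < d + β - 2 := by linarith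
  have hK : 0 < β * (d + β - 2) * l ^ β * r ^ (β - 2) := by positivity
  suffices h : F ≤ β * (d + β - 2) * l ^ β * r ^ (β - 2) ∧ -(4 * (β * (d + β - 2) * l ^ β * r ^ (β - 2))) ≤ F from
    ⟨h.1, abs_le.2 ⟨h.2, by linarith [h.1]⟩⟩
  subst hF
  split_ifs with c1 c2
  · constructor <;> linarith
  · have c1 : 1 ≤ l * r := not_lt.1 c1
    have e : l ^ β * r ^ (β - 2) = l ^ 2 * (l * r) ^ (β - 2) := by
      rw [Real.mul_rpow hl.le hr.le, Real.rpow_sub hl, Real.rpow_two]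
      field_simp
    have e2 : ((l * r) ^ 2)⁻¹ ≤ (l * r) ^ (β - 2) := by
      rw [← Real.rpow_two, ← Real.rpow_neg (by positivity)]
      exact Real.rpow_le_rpow_of_exponent_le c1 (by linarith)
    have e3 : r⁻¹ = l * (l * r)⁻¹ := by field_simp
    rw [mul_assoc _ (l ^ β), e, e3]
    generalize l * r = τ at *
    have hτ : 0 < τ := by linarith
    have e4 : 2 * (d - 1) * τ⁻¹ - d ≤ (d + β - 2) * (τ ^ 2)⁻¹ := by
      rw [← sub_nonneg]
      have : (d + β - 2) * (τ ^ 2)⁻¹ - (2 * (d - 1) * τ⁻¹ - d) = ((τ - 1) * (d * τ - (d - 2)) + β) / τ ^ 2 := by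
        field_simp; ring
      rw [this]
      have : 0 ≤ (τ - 1) * (d * τ - (d - 2)) := mul_nonneg (by linarith) (by nlinarith)
      positivity
    have e5 : -1 ≤ 2 * (d - 1) * τ⁻¹ - d := by
      have : (1:ℝ) / 2 ≤ τ⁻¹ := by rw [one_div]; exact inv_anti₀ hτ c2.le
      nlinarith
    have e6 : (1:ℝ) / 4 ≤ (τ ^ 2)⁻¹ := by
      rw [one_div]; exact inv_anti₀ (by positivity) (by nlinarith)
    have e7 : 2 * (d - 1) * τ⁻¹ - d ≤ (d + β - 2) * τ ^ (β - 2) := e4.trans (by gcongr)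
    have e8 : -(4 * ((d + β - 2) * τ ^ (β - 2))) ≤ 2 * (d - 1) * τ⁻¹ - d := by nlinarith
    have hb : 0 < β * l ^ 2 := by positivity
    have := mul_le_mul_of_nonneg_left e7 hb.le
    have := mul_le_mul_of_nonneg_left e8 hb.le
    constructor <;> linarith
  · constructor <;> linarith

/-- Claim Cl2 of the paper: `(−Δ)^{α/2}ψ_s = −I_{2−α}Δψ_s` satisfies
`−(1/γ(2−α)) ∫ |x−y|^{2−α−d} Δψ_s(y) dy ≥ −β(d+β−2)(γ(d+β−2)/γ(d+β−α)) s^{−β/α}|x|^{β−α}`. -/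
theorem frac_laplacian_weight_bound (d : ℕ) (hd : 3 ≤ d) (α β s : ℝ) (hα0 : 0 < α)
    (hα1 : α ≤ 1) (hβ0 : 0 < β) (hβα : β < α) (hs : 0 < s) (x : EuclideanSpace ℝ (Fin d))
    (hx : x ≠ 0) :
    Integrable
        (fun y : EuclideanSpace ℝ (Fin d) =>
          ‖x - y‖ ^ (2 - α - (d : ℝ)) * lap (psiW d α β s) y) volume ∧
      -(1 / gam d (2 - α)) *
          ∫ y : EuclideanSpace ℝ (Fin d), ‖x - y‖ ^ (2 - α - (d : ℝ)) * lap (psiW d α β s) y ≥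
        -(β * ((d : ℝ) + β - 2)) * (gam d ((d : ℝ) + β - 2) / gam d ((d : ℝ) + β - α)) *
          s ^ (-(β / α)) * ‖x‖ ^ (β - α) := by
  have hd3 : (3:ℝ) ≤ d := by exact_mod_cast hd
  obtain ⟨l, hl⟩ : ∃ l, l = s ^ (-(1 / α)) := ⟨_, rfl⟩
  have hl0 : 0 < l := by rw [hl]; positivity
  have hlβ : s ^ (-(β / α)) = l ^ β := by
    rw [hl, ← Real.rpow_mul hs.le]; congr 1; ring
  rw [hlβ]
  have : Nontrivial (EuclideanSpace ℝ (Fin d)) := ⟨x, 0, hx⟩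
  obtain ⟨F, hF⟩ : ∃ F : EuclideanSpace ℝ (Fin d) → ℝ, F = fun y =>
      if l * ‖y‖ < 1 then β * (d + β - 2) * l ^ β * ‖y‖ ^ (β - 2)
      else if l * ‖y‖ < 2 then 2 * β * (d - 1) * l * ‖y‖⁻¹ - d * β * l ^ 2 else 0 := ⟨_, rfl⟩
  have hFm : Measurable F := by
    rw [hF]
    refine Measurable.ite (measurableSet_lt (by fun_prop) (by fun_prop)) (by fun_prop) ?_
    exact Measurable.ite (measurableSet_lt (by fun_prop) (by fun_prop)) (by fun_prop) (by fun_prop)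
  have hae0 := Measure.ae_ne volume (0 : EuclideanSpace ℝ (Fin d))
  have hsph : ∀ r : ℝ, ∀ᵐ y : EuclideanSpace ℝ (Fin d), l * ‖y‖ ≠ r := by
    intro r
    have h0 := Measure.addHaar_sphere (volume : Measure (EuclideanSpace ℝ (Fin d))) 0 (r / l)
    rw [ae_iff]
    refine measure_mono_null ?_ h0
    intro y hy
    simp only [ne_eq, not_not, Set.mem_ofPred_eq] at hy
    rw [mem_sphere_zero_iff_norm, ← hy]
    field_simp
  have hlap : lap (psiW d α β s) =ᵐ[volume] F := by
    filter_upwards [hae0, hsph 1, hsph 2] with y hy h1 h2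
    rw [psi_near α β s hs hβ0 y hy l hl h1 h2, hF]
  have hbd : ∀ y : EuclideanSpace ℝ (Fin d), y ≠ 0 → _ := fun y hy =>
    profile_bound hd3 hβ0 hl0 (norm_pos_iff.2 hy) (F y) (by rw [hF])
  have hK : 0 < β * (d + β - 2) * l ^ β := by
    have : 0 < (d:ℝ) + β - 2 := by linarith
    positivity
  -- Riesz potential of a power
  have hR := lint_riesz hd x hx (p := (d - 2 + α) / 2) (q := (2 - β) / 2) (by linarith) (by linarith)
    (by linarith) (by linarith) (by linarith)
  rw [show -(2 * (((d:ℝ) - 2 + α) / 2)) = 2 - α - d by ring, show -(2 * ((2 - β) / 2)) = β - 2 by ring,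
    show -(2 * (((d:ℝ) - 2 + α) / 2 + (2 - β) / 2 - d / 2)) = β - α by ring,
    show ((d:ℝ) - 2 + α) / 2 + (2 - β) / 2 - d / 2 = (α - β) / 2 by ring,
    show (d:ℝ) / 2 - (d - 2 + α) / 2 = (2 - α) / 2 by ring,
    show (d:ℝ) / 2 - (2 - β) / 2 = (d + β - 2) / 2 by ring,
    show (d:ℝ) - (d - 2 + α) / 2 - (2 - β) / 2 = (d + β - α) / 2 by ring] at hR
  have hG1 : 0 < Real.Gamma ((α - β) / 2) := Real.Gamma_pos_of_pos (by linarith)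
  have hG2 : 0 < Real.Gamma ((2 - α) / 2) := Real.Gamma_pos_of_pos (by linarith)
  have hG3 : 0 < Real.Gamma ((d + β - 2) / 2) := Real.Gamma_pos_of_pos (by linarith)
  have hG4 : 0 < Real.Gamma ((d + β - α) / 2) := Real.Gamma_pos_of_pos (by linarith)
  have hG5 : 0 < Real.Gamma ((d - 2 + α) / 2) := Real.Gamma_pos_of_pos (by linarith)
  have hG6 : 0 < Real.Gamma ((2 - β) / 2) := Real.Gamma_pos_of_pos (by linarith)
  have hnn : ∀ y : EuclideanSpace ℝ (Fin d), 0 ≤ ‖x - y‖ ^ (2 - α - (d:ℝ)) * ‖y‖ ^ (β - 2) := fun y => by positivity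
  have hmR : Measurable (fun y : EuclideanSpace ℝ (Fin d) => ‖x - y‖ ^ (2 - α - (d:ℝ)) * ‖y‖ ^ (β - 2)) := by fun_prop
  have hIR : Integrable (fun y : EuclideanSpace ℝ (Fin d) => ‖x - y‖ ^ (2 - α - (d:ℝ)) * ‖y‖ ^ (β - 2)) := by
    refine ⟨hmR.aestronglyMeasurable, ?_⟩
    rw [hasFiniteIntegral_iff_ofReal (Filter.Eventually.of_forall hnn), hR]
    exact ENNReal.ofReal_lt_top
  have hval := integral_eq_lintegral_of_nonneg_ae (μ := volume) (Filter.Eventually.of_forall hnn) hmR.aestronglyMeasurable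
  rw [hR, ENNReal.toReal_ofReal (by positivity)] at hval
  have hint : Integrable (fun y : EuclideanSpace ℝ (Fin d) =>
      ‖x - y‖ ^ (2 - α - (d : ℝ)) * lap (psiW d α β s) y) volume := by
    have : Integrable (fun y : EuclideanSpace ℝ (Fin d) => ‖x - y‖ ^ (2 - α - (d : ℝ)) * F y) volume := by
      refine (hIR.const_mul (4 * (β * (d + β - 2) * l ^ β))).mono' (by fun_prop) ?_
      filter_upwards [hae0] with y hy
      rw [norm_mul, Real.norm_of_nonneg (by positivity), Real.norm_eq_abs]
      calc _ ≤ ‖x - y‖ ^ (2 - α - (d : ℝ)) * (4 * (β * (d + β - 2) * l ^ β * ‖y‖ ^ (β - 2))) := by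
            gcongr; exact (hbd y hy).2
        _ = _ := by ring
    refine this.congr ?_
    filter_upwards [hlap] with y hy
    rw [hy]
  refine ⟨hint, ?_⟩
  have hle : ∫ y : EuclideanSpace ℝ (Fin d), ‖x - y‖ ^ (2 - α - (d : ℝ)) * lap (psiW d α β s) y ≤
      ∫ y : EuclideanSpace ℝ (Fin d), (β * (d + β - 2) * l ^ β) * (‖x - y‖ ^ (2 - α - (d:ℝ)) * ‖y‖ ^ (β - 2)) := by
    refine integral_mono_ae hint (hIR.const_mul _) ?_
    filter_upwards [hlap, hae0] with y hy hy0
    rw [hy]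
    calc _ ≤ ‖x - y‖ ^ (2 - α - (d : ℝ)) * (β * (d + β - 2) * l ^ β * ‖y‖ ^ (β - 2)) := by
            gcongr; exact (hbd y hy0).1
        _ = _ := by ring
  rw [integral_const_mul, hval] at hle
  have hg : 0 < gam d (2 - α) := by
    unfold gam
    rw [show ((d:ℝ) - (2 - α)) / 2 = (d - 2 + α) / 2 by ring]
    positivity
  rw [ge_iff_le, neg_mul, neg_mul, neg_mul, neg_mul, neg_le_neg_iff]
  refine (mul_le_mul_of_nonneg_left hle (by positivity)).trans (le_of_eq ?_)
  unfold gam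
  rw [show ((d:ℝ) - (2 - α)) / 2 = (d - 2 + α) / 2 by ring,
    show ((d:ℝ) - (d + β - 2)) / 2 = (2 - β) / 2 by ring,
    show ((d:ℝ) - (d + β - α)) / 2 = (α - β) / 2 by ring,
    show (d:ℝ) + β - α = (d + β - 2) + (2 - α) by ring, Real.rpow_add two_pos]
  have h2a : (0:ℝ) < 2 ^ (2 - α) := by positivity
  have h2b : (0:ℝ) < 2 ^ ((d:ℝ) + β - 2) := by positivity
  have hpi : (0:ℝ) < π ^ ((d:ℝ) / 2) := by positivity
  rw [show (d:ℝ) + β - α = (d + β - 2) + (2 - α) by ring] at hG4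
  generalize (2:ℝ) ^ (2 - α) = A1 at *
  generalize (2:ℝ) ^ ((d:ℝ) + β - 2) = A2 at *
  generalize π ^ ((d:ℝ) / 2) = A3 at *
  generalize Real.Gamma ((α - β) / 2) = A4 at *
  generalize Real.Gamma ((2 - α) / 2) = A5 at *
  generalize Real.Gamma (((d:ℝ) + β - 2) / 2) = A6 at *
  generalize Real.Gamma (((d:ℝ) + β - 2 + (2 - α)) / 2) = A7 at *
  generalize Real.Gamma (((d:ℝ) - 2 + α) / 2) = A8 at *
  generalize Real.Gamma ((2 - β) / 2) = A9 at *
  generalize ‖x‖ ^ (β - α) = A10 at *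
  generalize l ^ β = A11 at *
  field_simp
end

section
/- Let d ≥ 3 be an integer, 0 < α ≤ 1, κ > 0, 0 < β < α, ε > 0, and s ∈ (0, 2]. Define b(x) := κ|x|^{−α}x (for x ≠ 0), b_ε(x) := κ(|x|^2+ε)^{−α/2}x, and let ψ_s(y) = η(s^{−1/α}|y|) where η(τ) = τ^β for 0 < τ < 1, η(τ) = βτ(2 − τ/2) + 1 − (3/2)β for 1 ≤ τ < 2, and η(τ) = 1 + β/2 for τ ≥ 2. Then for every x with 0 < |x| < 1 and s^{−1/α}|x| ∉ {1, 2}, writing |x|_ε := √(|x|^2+ε): div( (b_ε − b) ψ_s )(x) ≥ κ(d+β−α) ( |x|_ε^{−α} − |x|^{−α} ) ψ_s(x). (Note the right-hand side is ≤ 0.) -/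
open Real MeasureTheory

/-- Pointwise divergence of a vector field on `ℝ^d`: `∑ i ∂_{x_i} v^i(x)`. -/
noncomputable def pdiv {d : ℕ} (v : EuclideanSpace ℝ (Fin d) → EuclideanSpace ℝ (Fin d))
    (x : EuclideanSpace ℝ (Fin d)) : ℝ :=
  ∑ i : Fin d, fderiv ℝ v x (EuclideanSpace.single i 1) i

lemma pdiv_radial {d : ℕ} (G : ℝ → ℝ) (G' : ℝ) (x : EuclideanSpace ℝ (Fin d)) (hx : 0 < ‖x‖)
    (hG : HasDerivAt G G' ‖x‖) :
    pdiv (fun y : EuclideanSpace ℝ (Fin d) => G ‖y‖ • y) x = d * G ‖x‖ + ‖x‖ * G' := by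
  have hx' : x ≠ 0 := norm_pos_iff.mp hx
  have hn : DifferentiableAt ℝ (fun y : EuclideanSpace ℝ (Fin d) => ‖y‖) x :=
    (contDiffAt_norm ℝ hx' (n := 1)).differentiableAt (by norm_num)
  have hs := hn.fderiv_norm_self
  have hN := hn.hasFDerivAt
  set L := fderiv ℝ (fun y : EuclideanSpace ℝ (Fin d) => ‖y‖) x with hL
  have h1 := (hG.comp_hasFDerivAt x hN).smul (hasFDerivAt_id x)
  have hf : fderiv ℝ (fun y : EuclideanSpace ℝ (Fin d) => G ‖y‖ • y) x = _ := h1.fderiv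
  unfold pdiv
  rw [hf]
  have hLx : ∑ i : Fin d, L (EuclideanSpace.single i 1) * x i = ‖x‖ := by
    have hxs : x = ∑ i : Fin d, x i • EuclideanSpace.single i (1 : ℝ) := by
      ext j
      simp [Pi.single_apply]
    rw [← hs]
    conv_rhs => rw [hxs]
    rw [map_sum]
    refine Finset.sum_congr rfl fun i _ => ?_
    rw [map_smul, smul_eq_mul, mul_comm]
  simp [Finset.sum_add_distrib, mul_assoc, ← Finset.mul_sum, hLx]
  ring

lemma eta_deriv (β τ : ℝ) (hβ0 : 0 < β) (hτ : 0 < τ) (h1 : τ ≠ 1) (h2 : τ ≠ 2) :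
    ∃ e, HasDerivAt (eta β) e τ ∧ τ * e ≤ β * eta β τ ∧ 0 ≤ eta β τ := by
  rcases lt_or_gt_of_ne h1 with h | h
  · refine ⟨β * τ ^ (β - 1), ?_, ?_, ?_⟩
    · refine (Real.hasDerivAt_rpow_const (Or.inl hτ.ne')).congr_of_eventuallyEq ?_
      filter_upwards [Iio_mem_nhds h] with t ht
      simp only [Set.mem_Iio] at ht
      simp [eta, ht]
    · simp only [eta, h, if_true]
      rw [Real.rpow_sub_one hτ.ne']
      apply le_of_eq; field_simp
    · simp only [eta, h, if_true]; positivity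
  · have n1 : ¬ τ < 1 := by linarith
    rcases lt_or_gt_of_ne h2 with h' | h'
    · have hge : 1 ≤ eta β τ := by
        simp only [eta, n1, h', if_true, if_false]
        have : 0 ≤ τ * (2 - τ/2) - 3/2 := by nlinarith
        nlinarith
      refine ⟨β * (2 - τ), ?_, ?_, by linarith⟩
      · have : HasDerivAt (fun t : ℝ => β * t * (2 - t / 2) + 1 - 3 / 2 * β) (β * (2 - τ)) τ := by
          have := ((((hasDerivAt_id τ).const_mul β).mul
            (((hasDerivAt_id τ).div_const 2).const_sub 2)).add_const 1).sub_const (3/2*β)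
          refine HasDerivAt.congr_deriv this ?_
          simp only [id]; ring
        refine this.congr_of_eventuallyEq ?_
        filter_upwards [Ioo_mem_nhds h h'] with t ht
        have : ¬ t < 1 := by linarith [ht.1]
        simp [eta, this, ht.2]
      · have : τ * (2 - τ) ≤ 1 := by nlinarith [sq_nonneg (τ - 1)]
        nlinarith
    · have n2 : ¬ τ < 2 := by linarith
      have hge : 0 ≤ eta β τ := by
        simp only [eta, n1, n2, if_false]; positivity
      refine ⟨0, ?_, ?_, hge⟩
      · refine (hasDerivAt_const τ (1 + β / 2)).congr_of_eventuallyEq ?_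
        filter_upwards [Ioi_mem_nhds h'] with t ht
        simp only [Set.mem_Ioi] at ht
        have a : ¬ t < 1 := by linarith
        have b : ¬ t < 2 := by linarith
        simp [eta, a, b]
      · rw [mul_zero]; positivity

/-- Inner-region estimate of Claim Cl3: for `0 < |x| < 1` (away from the spheres
`s^{−1/α}|x| ∈ {1,2}`), `div((b_ε − b)ψ_s)(x) ≥ κ(d+β−α)(|x|_ε^{−α} − |x|^{−α})ψ_s(x)`. -/
theorem div_regularization_error_inner (d : ℕ) (hd : 3 ≤ d) (α β κ ε s : ℝ) (hα0 : 0 < α)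
    (hα1 : α ≤ 1) (hκ : 0 < κ) (hβ0 : 0 < β) (hβα : β < α) (hε : 0 < ε) (hs0 : 0 < s)
    (hs2 : s ≤ 2) (x : EuclideanSpace ℝ (Fin d)) (hx0 : 0 < ‖x‖) (hx1 : ‖x‖ < 1)
    (hxs1 : s ^ (-(1 / α)) * ‖x‖ ≠ 1) (hxs2 : s ^ (-(1 / α)) * ‖x‖ ≠ 2) :
    pdiv
        (fun y : EuclideanSpace ℝ (Fin d) =>
          psiW d α β s y •
            ((κ * (‖y‖ ^ 2 + ε) ^ (-(α / 2))) • y - (κ * ‖y‖ ^ (-α)) • y)) x ≥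
      κ * ((d : ℝ) + β - α) * (Real.sqrt (‖x‖ ^ 2 + ε) ^ (-α) - ‖x‖ ^ (-α)) *
        psiW d α β s x := by
  set r := ‖x‖ with hr
  set c := s ^ (-(1 / α)) with hc
  have hc0 : 0 < c := Real.rpow_pos_of_pos hs0 _
  obtain ⟨e, he, hle, hpos⟩ := eta_deriv β (c * r) hβ0 (by positivity) hxs1 hxs2
  have hq : 0 < r ^ 2 + ε := by positivity
  have hE : HasDerivAt (fun t : ℝ => eta β (c * t)) (e * c) r := by
    have h0 : HasDerivAt (fun t : ℝ => c * t) c r := by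
      simpa using (hasDerivAt_id r).const_mul c
    exact HasDerivAt.comp r he h0
  have hA : HasDerivAt (fun t : ℝ => (t ^ 2 + ε) ^ (-(α / 2)))
      (2 * r * (-(α / 2)) * (r ^ 2 + ε) ^ (-(α / 2) - 1)) r := by
    have h0 : HasDerivAt (fun t : ℝ => t ^ 2 + ε) (2 * r) r := by
      simpa using (hasDerivAt_pow 2 r).add_const ε
    exact h0.rpow_const (Or.inl hq.ne')
  have hB : HasDerivAt (fun t : ℝ => t ^ (-α)) (-α * r ^ (-α - 1)) r :=
    Real.hasDerivAt_rpow_const (Or.inl hx0.ne')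
  have hG := hE.mul ((hA.const_mul κ).sub (hB.const_mul κ))
  have key := pdiv_radial _ _ x hx0 hG
  have hfun : (fun y : EuclideanSpace ℝ (Fin d) =>
          psiW d α β s y •
            ((κ * (‖y‖ ^ 2 + ε) ^ (-(α / 2))) • y - (κ * ‖y‖ ^ (-α)) • y)) =
      fun y => ((fun t : ℝ => eta β (c * t)) * ((fun t : ℝ => κ * (t ^ 2 + ε) ^ (-(α / 2))) -
        fun t : ℝ => κ * t ^ (-α))) ‖y‖ • y := by
    funext y
    simp only [psiW, Pi.mul_apply, Pi.sub_apply, ← sub_smul, smul_smul, ← hc]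
  have hsq : Real.sqrt (r ^ 2 + ε) ^ (-α) = (r ^ 2 + ε) ^ (-(α / 2)) := by
    rw [Real.sqrt_eq_rpow, ← Real.rpow_mul hq.le]
    congr 1; ring
  have hrB : r ^ (-α) = (r ^ 2) ^ (-(α / 2)) := by
    rw [← Real.rpow_natCast, ← Real.rpow_mul hx0.le]
    congr 1; push_cast; ring
  have hAB : (r ^ 2 + ε) ^ (-(α / 2)) ≤ r ^ (-α) := by
    rw [hrB]
    exact Real.rpow_le_rpow_of_nonpos (by positivity) (by linarith) (by linarith)
  have hA0 : 0 < (r ^ 2 + ε) ^ (-(α / 2)) := Real.rpow_pos_of_pos hq _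
  rw [hfun]
  refine ge_iff_le.mpr (le_of_le_of_eq ?_ key.symm)
  rw [hsq]
  simp only [psiW, ← hc, ← hr, Pi.mul_apply, Pi.sub_apply]
  rw [Real.rpow_sub_one hq.ne', Real.rpow_sub_one hx0.ne']
  generalize (r ^ 2 + ε) ^ (-(α / 2)) = A at *
  generalize r ^ (-α) = B at *
  generalize eta β (c * r) = E at *
  have h1 : A * (r ^ 2 / (r ^ 2 + ε)) ≤ A := by
    apply mul_le_of_le_one_right hA0.le
    rw [div_le_one hq]; linarith
  have h2 : r * (e * c * (κ * A - κ * B) + E * (κ * (2 * r * (-(α / 2)) * (A / (r ^ 2 + ε))) -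
      κ * (-α * (B / r)))) =
      κ * (c * r * e) * (A - B) + κ * α * E * (B - A * (r ^ 2 / (r ^ 2 + ε))) := by
    field_simp
    ring
  rw [h2]
  have h3 : 0 ≤ κ * ((β * E - c * r * e) * (B - A)) :=
    mul_nonneg hκ.le (mul_nonneg (by linarith) (by linarith))
  have h4 : 0 ≤ κ * α * E * (A - A * (r ^ 2 / (r ^ 2 + ε))) :=
    mul_nonneg (by positivity) (by linarith)
  linarith
end
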